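/- There exist an infinite set 𝒜 = {a_1 < a_2 < …} of natural numbers and a constant C > 0 such that E(A_N) ≤ C·N³/log N for all N ≥ 2 (where A_N is the set of the first N elements of 𝒜), yet 𝒜 is not metric Poissonian. -/

import Mathlib

open MeasureTheory Filter Finset
open scoped Classical

/-- Distance from a real number to the nearest integer. -/
noncomputable def intDist (x : ℝ) : ℝ := |x - round x|

/-- The pair correlation function `F(𝒜, α, s, N)` for the sequence `a` (1-indexed):
`(1/N) · #{(i,j) : 1 ≤ i,j ≤ N, i ≠ j, ‖α(a_i − a_j)‖ ≤ s/N}`. -/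
noncomputable def pairCorr (a : ℕ → ℕ) (α s : ℝ) (N : ℕ) : ℝ :=
  (((Finset.Icc 1 N ×ˢ Finset.Icc 1 N).filter
    (fun p => p.1 ≠ p.2 ∧ intDist (α * ((a p.1 : ℝ) - (a p.2 : ℝ))) ≤ s / N)).card : ℝ) / N

/-- A (strictly increasing) sequence is metric Poissonian if for a.e. `α ∈ [0,1]` and
every `s > 0`, `F(𝒜, α, s, N) → 2s`. -/
def MetricPoissonian (a : ℕ → ℕ) : Prop :=
  ∀ᵐ α ∂(volume.restrict (Set.Icc (0:ℝ) 1)),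
    ∀ s : ℝ, 0 < s → Tendsto (fun N => pairCorr a α s N) atTop (nhds (2 * s))

/-- The additive energy of a finite set of naturals: the number of quadruples
`(b₁,b₂,b₃,b₄) ∈ B⁴` with `b₁ + b₂ = b₃ + b₄`. -/
def addEnergy (B : Finset ℕ) : ℕ :=
  ((B ×ˢ B ×ˢ B ×ˢ B).filter (fun q => q.1 + q.2.1 = q.2.2.1 + q.2.2.2)).card

/-- The first `N` elements of the set associated to the (1-indexed) sequence `a`. -/
def firstN (a : ℕ → ℕ) (N : ℕ) : Finset ℕ := (Finset.Icc 1 N).image a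

/-- The increasing sequence of all primes, 1-indexed: `primeSeq 1 = 2`, `primeSeq 2 = 3`, … -/
noncomputable def primeSeq (n : ℕ) : ℕ := Nat.nth Nat.Prime (n - 1)


/-- Exponent of the (slowly growing) padding ratio at scale `k`. -/
def tau (k : ℕ) : ℕ := Nat.log 8 k

/-- Length of the progression at scale `k`. -/
def blk (k : ℕ) : ℕ := 2 ^ (k - tau k)

/-- Head (first index) of the block containing index `n`. -/
def hd (n : ℕ) : ℕ :=
  if n = 0 then 0 else
    if n < 2 ^ (Nat.log 2 n) + blk (Nat.log 2 n) then 2 ^ (Nat.log 2 n) else n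

/-- The exponent of the common difference of the block with head `h`. -/
def ex (h : ℕ) : ℕ := (h + 2) ^ 2

/-- The sequence. -/
def sqn (n : ℕ) : ℕ := 2 ^ ex (hd n) * (8 * hd n + 8 + (n - hd n))

theorem tau_le (k : ℕ) : tau k ≤ k := Nat.log_le_self 8 k

theorem tau_le' (k : ℕ) (hk : 2 ≤ k) : 2 * tau k + 2 ≤ k := by
  have h1 : 8 ^ tau k ≤ k := Nat.pow_log_le_self 8 (by omega)
  have h2 : 1 + tau k * 7 ≤ (1 + 7) ^ tau k := by
    have := one_add_mul_le_pow (R := ℤ) (a := 7) (by norm_num) (tau k)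
    zify
    exact_mod_cast this
  norm_num at h2
  rcases Nat.eq_zero_or_pos (tau k) with h | h <;> omega

theorem lt_tau (k : ℕ) : k + 1 ≤ 8 * 8 ^ tau k := by
  have := Nat.lt_pow_succ_log_self (b := 8) (by norm_num) k
  unfold tau
  rw [pow_succ] at this
  omega

theorem blk_le (k : ℕ) : blk k ≤ 2 ^ k := Nat.pow_le_pow_right (by norm_num) (by omega)

theorem hd_le (n : ℕ) : hd n ≤ n := by
  unfold hd
  split_ifs with h h1
  · omega
  · exact Nat.pow_log_le_self 2 h
  · exact le_rfl

theorem le_hd (n : ℕ) : n ≤ 2 * hd n := by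
  unfold hd
  split_ifs with h h1
  · omega
  · have := Nat.lt_pow_succ_log_self (b := 2) (by norm_num) n
    rw [pow_succ] at this
    omega
  · omega

theorem hd_mono {i j : ℕ} (hij : i ≤ j) : hd i ≤ hd j := by
  rcases Nat.eq_zero_or_pos i with h0 | h0
  · subst h0; simp [hd]
  have hlog : Nat.log 2 i ≤ Nat.log 2 j := Nat.log_mono_right hij
  by_cases hj : j < 2 ^ (Nat.log 2 j) + blk (Nat.log 2 j)
  · have e : hd j = 2 ^ (Nat.log 2 j) := by unfold hd; rw [if_neg (by omega), if_pos hj]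
    rcases hlog.lt_or_eq with h | h
    · rw [e]
      refine (hd_le i).trans ?_
      exact (Nat.lt_pow_of_log_lt (by norm_num) h).le
    · have e' : hd i = 2 ^ (Nat.log 2 i) := by
        unfold hd; rw [if_neg (by omega), if_pos]; rw [h]; omega
      rw [e, e', h]
  · have e : hd j = j := by unfold hd; rw [if_neg (by omega), if_neg hj]
    rw [e]; exact (hd_le i).trans hij

theorem hd_block (k n : ℕ) (h1 : 2 ^ k ≤ n) (h2 : n < 2 ^ k + blk k) : hd n = 2 ^ k := by
  have h3 := blk_le k
  have h0 : n ≠ 0 := by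
    have : 0 < 2 ^ k := by positivity
    omega
  have hl : Nat.log 2 n = k := by
    apply Nat.log_eq_of_pow_le_of_lt_pow h1
    rw [pow_succ]; omega
  unfold hd
  rw [if_neg h0, hl, if_pos h2]

/-- Two indices with the same head are equal or lie in the same progression. -/
theorem hd_eq {i j : ℕ} (h : hd i = hd j) (hij : i ≠ j) :
    Nat.log 2 i = Nat.log 2 j ∧ 2 ^ Nat.log 2 i ≤ i ∧
      i < 2 ^ Nat.log 2 i + blk (Nat.log 2 i) ∧ 2 ^ Nat.log 2 j ≤ j ∧
      j < 2 ^ Nat.log 2 j + blk (Nat.log 2 j) := by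
  have hp : ∀ k : ℕ, 0 < 2 ^ k := fun k => by positivity
  have hb : ∀ k : ℕ, 0 < blk k := fun k => by unfold blk; positivity
  have hi0 : i ≠ 0 := by
    rintro rfl
    have := le_hd j
    have : hd 0 = 0 := by simp [hd]
    omega
  have hj0 : j ≠ 0 := by
    rintro rfl
    have := le_hd i
    have : hd 0 = 0 := by simp [hd]
    omega
  have li := Nat.pow_log_le_self 2 hi0
  have lj := Nat.pow_log_le_self 2 hj0
  have inj : ∀ k l : ℕ, 2 ^ k = 2 ^ l → k = l := fun k l e => Nat.pow_right_injective le_rfl e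
  by_cases ci : i < 2 ^ Nat.log 2 i + blk (Nat.log 2 i)
  · by_cases cj : j < 2 ^ Nat.log 2 j + blk (Nat.log 2 j)
    · unfold hd at h
      rw [if_neg hi0, if_neg hj0, if_pos ci, if_pos cj] at h
      exact ⟨inj _ _ h, li, ci, lj, cj⟩
    · unfold hd at h
      rw [if_neg hi0, if_neg hj0, if_pos ci, if_neg cj] at h
      exfalso
      rw [← h, Nat.log_pow (by norm_num)] at cj
      have := hb (Nat.log 2 i)
      omega
  · by_cases cj : j < 2 ^ Nat.log 2 j + blk (Nat.log 2 j)
    · unfold hd at h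
      rw [if_neg hi0, if_neg hj0, if_neg ci, if_pos cj] at h
      exfalso
      rw [h, Nat.log_pow (by norm_num)] at ci
      have := hb (Nat.log 2 j)
      omega
    · unfold hd at h
      rw [if_neg hi0, if_neg hj0, if_neg ci, if_neg cj] at h
      exact absurd h hij

theorem ex_mono {h h' : ℕ} (hh : h ≤ h') : ex h ≤ ex h' := by
  unfold ex; gcongr

theorem sq_lower {i j : ℕ} (h : hd i < hd j) : 2 * sqn i < 2 ^ ex (hd j) := by
  have h1 : 2 ^ ex (hd i + 1) ≤ 2 ^ ex (hd j) := Nat.pow_le_pow_right (by norm_num) (ex_mono h)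
  refine lt_of_lt_of_le ?_ h1
  have h2 : ex (hd i + 1) = ex (hd i) + (2 * hd i + 5) := by unfold ex; ring
  have h3 : hd i < 2 ^ hd i := Nat.lt_two_pow_self
  have h4 : 2 ^ (2 * hd i + 5) = 32 * (2 ^ hd i * 2 ^ hd i) := by
    rw [pow_add, two_mul, pow_add]; ring
  rw [h2, pow_add, h4]
  unfold sqn
  have h5 := le_hd i
  have h6 : 0 < 2 ^ ex (hd i) := by positivity
  have h7 : 2 * (8 * hd i + 8 + (i - hd i)) < 32 * (2 ^ hd i * 2 ^ hd i) := by
    have : 2 ^ hd i * 1 ≤ 2 ^ hd i * 2 ^ hd i := Nat.mul_le_mul_left _ Nat.one_le_two_pow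
    omega
  calc 2 * (2 ^ ex (hd i) * (8 * hd i + 8 + (i - hd i)))
      = 2 ^ ex (hd i) * (2 * (8 * hd i + 8 + (i - hd i))) := by ring
    _ < _ := Nat.mul_lt_mul_of_pos_left h7 h6

theorem le_sq (i : ℕ) : 2 ^ ex (hd i) ≤ sqn i := by
  unfold sqn
  exact Nat.le_mul_of_pos_right _ (by omega)

theorem sqn_strictMono : StrictMono sqn := by
  intro i j hij
  rcases (hd_mono hij.le).lt_or_eq with h | h
  · have := sq_lower h
    have := le_sq j
    omega
  · unfold sqn
    rw [h]
    have h1 := hd_le i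
    apply Nat.mul_lt_mul_of_pos_left _ (by positivity)
    omega

theorem sq_ordered {i j k l : ℕ} (h1 : j ≤ l) (h2 : l ≤ k) (h3 : k ≤ i)
    (h : sqn i + sqn j = sqn k + sqn l) :
    i = k ∨ (hd i = hd k ∧ hd i = hd l ∧ hd i = hd j) := by
  have mkl := sqn_strictMono.monotone h2
  have e1 : hd k = hd i := by
    rcases (hd_mono h3).lt_or_eq with c | c
    · have := sq_lower c
      have := le_sq i
      omega
    · exact c
  have hik := hd_le k
  have key : sqn i = sqn k + 2 ^ ex (hd i) * (i - k) := by
    unfold sqn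
    rw [e1, ← mul_add]
    congr 1
    omega
  rcases (hd_mono (h1.trans (h2.trans h3))).lt_or_eq with c | c
  · left
    rcases (hd_mono (h2.trans h3)).lt_or_eq with d | d
    · have := sq_lower d
      by_contra hne
      have : 2 ^ ex (hd i) * 1 ≤ 2 ^ ex (hd i) * (i - k) := Nat.mul_le_mul_left _ (by omega)
      omega
    · exfalso
      have lo := sq_lower c
      have : sqn l = 2 ^ ex (hd i) * (8 * hd i + 8 + (l - hd i)) := by unfold sqn; rw [d]
      have hi2 := le_hd i
      have : 2 ^ ex (hd i) * (i - k + 1) ≤ 2 ^ ex (hd i) * (8 * hd i + 8 + (l - hd i)) :=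
        Nat.mul_le_mul_left _ (by omega)
      rw [mul_add] at this
      omega
  · right
    refine ⟨e1.symm, ?_, c.symm⟩
    have := hd_mono h1
    have := hd_mono (h2.trans h3)
    omega

theorem sq_four {i j k l : ℕ} (h : sqn i + sqn j = sqn k + sqn l) :
    i = k ∨ i = l ∨ (hd i = hd j ∧ hd i = hd k ∧ hd i = hd l) := by
  have hm := sqn_strictMono
  have inj : ∀ x y, sqn x = sqn y → x = y := fun x y e => hm.injective e
  have lt : ∀ x y, sqn x ≤ sqn y → x ≤ y := fun x y e => hm.le_iff_le.1 e
  have le : ∀ x y, x ≤ y → sqn x ≤ sqn y := fun x y e => hm.le_iff_le.2 e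
  rcases le_total (sqn i) (sqn j) with a | a <;> rcases le_total (sqn k) (sqn l) with b | b
  · rcases le_total (sqn j) (sqn l) with c | c
    · have := sq_ordered (lt _ _ (by omega : sqn k ≤ sqn i)) (lt _ _ a) (lt _ _ c) (by omega)
      rcases this with e | e
      · left; subst e; apply inj; omega
      · right; right; omega
    · have := sq_ordered (lt _ _ (by omega : sqn i ≤ sqn k)) (lt _ _ b) (lt _ _ c) (by omega)
      rcases this with e | e
      · left; subst e; apply inj; omega
      · right; right; omega
  · rcases le_total (sqn j) (sqn k) with c | c
    · have := sq_ordered (lt _ _ (by omega : sqn l ≤ sqn i)) (lt _ _ a) (lt _ _ c) (by omega)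
      rcases this with e | e
      · right; left; subst e; apply inj; omega
      · right; right; omega
    · have := sq_ordered (lt _ _ (by omega : sqn i ≤ sqn l)) (lt _ _ b) (lt _ _ c) (by omega)
      rcases this with e | e
      · right; left; subst e; apply inj; omega
      · right; right; omega
  · rcases le_total (sqn i) (sqn l) with c | c
    · have := sq_ordered (lt _ _ (by omega : sqn k ≤ sqn j)) (lt _ _ a) (lt _ _ c) (by omega)
      rcases this with e | e
      · right; left; omega
      · right; right; omega
    · have := sq_ordered (lt _ _ (by omega : sqn j ≤ sqn k)) (lt _ _ b) (lt _ _ c) (by omega)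
      rcases this with e | e
      · right; left; omega
      · right; right; omega
  · rcases le_total (sqn i) (sqn k) with c | c
    · have := sq_ordered (lt _ _ (by omega : sqn l ≤ sqn j)) (lt _ _ a) (lt _ _ c) (by omega)
      rcases this with e | e
      · left; omega
      · right; right; omega
    · have := sq_ordered (lt _ _ (by omega : sqn j ≤ sqn l)) (lt _ _ b) (lt _ _ c) (by omega)
      rcases this with e | e
      · left; omega
      · right; right; omega

/-- Triples of indices used to bound the energy. -/
def triples (N : ℕ) : Finset (ℕ × ℕ × ℕ) :=
  (Finset.Icc 1 N).image (fun i => (i, i, i)) ∪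
    (Finset.range (Nat.log 2 N + 1)).biUnion (fun k =>
      Finset.Ico (2 ^ k) (2 ^ k + blk k) ×ˢ Finset.Ico (2 ^ k) (2 ^ k + blk k) ×ˢ
        Finset.Ico (2 ^ k) (2 ^ k + blk k))

theorem triples_card (N : ℕ) :
    (triples N).card ≤ N + ∑ k ∈ Finset.range (Nat.log 2 N + 1), blk k ^ 3 := by
  unfold triples
  refine (Finset.card_union_le _ _).trans ?_
  refine add_le_add ?_ ?_
  · refine Finset.card_image_le.trans ?_
    simp
  · refine Finset.card_biUnion_le.trans ?_
    refine Finset.sum_le_sum fun k _ => ?_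
    simp only [Finset.card_product, Nat.card_Ico]
    simp only [Nat.add_sub_cancel_left]
    exact le_of_eq (by ring)

theorem mem_triples {N i j k : ℕ} (hi : i ∈ Finset.Icc 1 N) (hj : j ∈ Finset.Icc 1 N)
    (hk : k ∈ Finset.Icc 1 N) (h1 : hd i = hd j) (h2 : hd i = hd k) :
    (i, j, k) ∈ triples N := by
  unfold triples
  simp only [Finset.mem_Icc] at hi hj hk
  rw [Finset.mem_union]
  have hlog : ∀ x, x ≤ N → Nat.log 2 x < Nat.log 2 N + 1 := fun x hx =>
    Nat.lt_succ_of_le (Nat.log_mono_right hx)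
  by_cases hij : i = j
  · by_cases hik : i = k
    · left
      subst hij; subst hik
      simp; omega
    · right
      subst hij
      obtain ⟨a, b, c, d, e⟩ := hd_eq h2 hik
      rw [← a] at d e
      simp only [Finset.mem_biUnion, Finset.mem_range, Finset.mem_product, Finset.mem_Ico]
      exact ⟨Nat.log 2 i, hlog _ hi.2, ⟨b, c⟩, ⟨b, c⟩, ⟨d, e⟩⟩
  · right
    obtain ⟨a, b, c, d, e⟩ := hd_eq h1 hij
    rw [← a] at d e
    simp only [Finset.mem_biUnion, Finset.mem_range, Finset.mem_product, Finset.mem_Ico]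
    refine ⟨Nat.log 2 i, hlog _ hi.2, ⟨b, c⟩, ⟨d, e⟩, ?_⟩
    by_cases hik : i = k
    · subst hik; exact ⟨b, c⟩
    · obtain ⟨a', b', c', d', e'⟩ := hd_eq h2 hik
      rw [← a'] at d' e'
      exact ⟨d', e'⟩

theorem energy_le (N : ℕ) :
    _root_.addEnergy (firstN sqn N) ≤
      2 * N ^ 2 + (N + ∑ k ∈ Finset.range (Nat.log 2 N + 1), blk k ^ 3) := by
  have hsub : ((firstN sqn N ×ˢ firstN sqn N ×ˢ firstN sqn N ×ˢ firstN sqn N).filter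
      (fun q => q.1 + q.2.1 = q.2.2.1 + q.2.2.2)) ⊆
      ((Finset.Icc 1 N ×ˢ Finset.Icc 1 N).image
        (fun p => (sqn p.1, sqn p.2, sqn p.1, sqn p.2))) ∪
      ((Finset.Icc 1 N ×ˢ Finset.Icc 1 N).image
        (fun p => (sqn p.1, sqn p.2, sqn p.2, sqn p.1))) ∪
      (triples N).image (fun t => (sqn t.1, sqn t.2.1, sqn t.2.2, sqn t.1 + sqn t.2.1 - sqn t.2.2)) := by
    rintro ⟨x, y, z, w⟩ hq
    simp only [firstN, Finset.mem_filter, Finset.mem_product, Finset.mem_image] at hq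
    obtain ⟨⟨⟨i, hi, rfl⟩, ⟨j, hj, rfl⟩, ⟨k, hk, rfl⟩, ⟨l, hl, rfl⟩⟩, he⟩ := hq
    rw [Finset.mem_union, Finset.mem_union]
    rcases sq_four he with e | e | ⟨e1, e2, e3⟩
    · left; left
      subst e
      have : sqn l = sqn j := by omega
      rw [this]
      exact Finset.mem_image.2 ⟨(i, j), Finset.mem_product.2 ⟨hi, hj⟩, rfl⟩
    · left; right
      subst e
      have : sqn k = sqn j := by omega
      rw [this]
      exact Finset.mem_image.2 ⟨(i, j), Finset.mem_product.2 ⟨hi, hj⟩, rfl⟩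
    · right
      have : sqn l = sqn i + sqn j - sqn k := by omega
      rw [this]
      exact Finset.mem_image.2 ⟨(i, j, k), mem_triples hi hj hk e1 e2, rfl⟩
  unfold _root_.addEnergy
  refine le_trans (le_of_eq (by congr)) ((Finset.card_le_card hsub).trans ?_)
  refine (Finset.card_union_le _ _).trans ?_
  refine add_le_add ?_ (Finset.card_image_le.trans (triples_card N))
  refine (Finset.card_union_le _ _).trans ?_
  have hc : (Finset.Icc 1 N ×ˢ Finset.Icc 1 N).card = N ^ 2 := by
    simp [Finset.card_product]
    ring
  rw [two_mul]
  exact add_le_add (Finset.card_image_le.trans hc.le) (Finset.card_image_le.trans hc.le)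

theorem blk_cube (k : ℕ) : (blk k : ℝ) ^ 3 ≤ 8 * (8 ^ k / (k + 1)) := by
  have h1 : blk k ^ 3 * 8 ^ tau k = 8 ^ k := by
    unfold blk
    rw [show (8:ℕ) = 2 ^ 3 by norm_num, ← pow_mul, ← pow_mul, ← pow_mul, ← pow_add]
    congr 1
    have := tau_le k
    omega
  have h2 := lt_tau k
  have h1' : (blk k : ℝ) ^ 3 * 8 ^ tau k = 8 ^ k := by exact_mod_cast h1
  have h2' : (k : ℝ) + 1 ≤ 8 * 8 ^ tau k := by exact_mod_cast h2
  rw [← mul_div_assoc, le_div_iff₀ (by positivity), ← h1']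
  have : (0:ℝ) ≤ (blk k : ℝ) ^ 3 := by positivity
  nlinarith

theorem sum_pow_div (K : ℕ) :
    ∑ k ∈ Finset.range (K + 1), (8 : ℝ) ^ k / (k + 1) ≤ 2 * (8 ^ K / (K + 1)) := by
  induction K with
  | zero => simp
  | succ K ih =>
    rw [Finset.sum_range_succ]
    have : (2:ℝ) * (8 ^ K / (K + 1)) ≤ 8 ^ (K + 1) / ((K + 1 : ℕ) + 1) := by
      rw [← mul_div_assoc, div_le_div_iff₀ (by positivity) (by positivity), pow_succ]
      push_cast
      have : (0:ℝ) < 8 ^ K := by positivity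
      have hK : (0:ℝ) ≤ K := by positivity
      nlinarith [mul_nonneg this.le hK]
    linarith

theorem energy_bound (N : ℕ) (hN : 2 ≤ N) :
    (_root_.addEnergy (firstN sqn N) : ℝ) ≤ 19 * (N : ℝ) ^ 3 / Real.log N := by
  have h0 : (_root_.addEnergy (firstN sqn N) : ℝ) ≤
      2 * (N : ℝ) ^ 2 + (N + ∑ k ∈ Finset.range (Nat.log 2 N + 1), (blk k : ℝ) ^ 3) := by
    exact_mod_cast energy_le N
  have hN' : (2:ℝ) ≤ N := by exact_mod_cast hN
  have hlog : 0 < Real.log N := Real.log_pos (by linarith)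
  have hlogN : Real.log N ≤ N := (Real.log_le_sub_one_of_pos (by linarith)).trans (by linarith)
  set K := Nat.log 2 N with hK
  have h1 : ∑ k ∈ Finset.range (K + 1), (blk k : ℝ) ^ 3 ≤ 16 * (8 ^ K / (K + 1)) := by
    calc _ ≤ ∑ k ∈ Finset.range (K + 1), 8 * ((8:ℝ) ^ k / (k + 1)) :=
          Finset.sum_le_sum fun k _ => blk_cube k
      _ = 8 * ∑ k ∈ Finset.range (K + 1), ((8:ℝ) ^ k / (k + 1)) := by rw [Finset.mul_sum]
      _ ≤ _ := by linarith [sum_pow_div K]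
  have h2 : (8:ℝ) ^ K ≤ (N:ℝ) ^ 3 := by
    have : 2 ^ K ≤ N := Nat.pow_log_le_self 2 (by omega)
    have h : (2:ℝ) ^ K ≤ N := by exact_mod_cast this
    calc (8:ℝ) ^ K = (2 ^ K) ^ 3 := by rw [← pow_mul, mul_comm, pow_mul]; norm_num
      _ ≤ _ := by gcongr
  have h3 : Real.log N ≤ K + 1 := by
    have : N < 2 ^ (K + 1) := Nat.lt_pow_succ_log_self (by norm_num) N
    have h : (N:ℝ) ≤ 2 ^ (K + 1) := by exact_mod_cast this.le
    have h' := Real.log_le_log (by linarith) h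
    rw [Real.log_pow] at h'
    push_cast at h'
    have := Real.log_two_lt_d9
    have hK0 : (0:ℝ) ≤ K := by positivity
    nlinarith
  have h4 : (8:ℝ) ^ K / (K + 1) ≤ (N:ℝ) ^ 3 / Real.log N := by gcongr
  have h5 : (N:ℝ) ^ 2 ≤ (N:ℝ) ^ 3 / Real.log N := by
    rw [le_div_iff₀ hlog, pow_succ (N:ℝ) 2]
    gcongr
  have h6 : (N:ℝ) ≤ (N:ℝ) ^ 2 := by nlinarith
  rw [mul_div_assoc]
  linarith

theorem totient_sum (J : ℕ) : J ^ 2 ≤ 16 * ∑ j ∈ Finset.Icc 1 J, Nat.totient j := by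
  have h1 : ∑ j ∈ Finset.Icc 1 J, Nat.totient j * (J / j) = ∑ n ∈ Finset.Icc 1 J, n := by
    have hn : ∀ n ∈ Finset.Icc 1 J,
        n = ∑ j ∈ Finset.Icc 1 J, if j ∣ n then Nat.totient j else 0 := by
      intro n hn
      rw [Finset.mem_Icc] at hn
      conv_lhs => rw [← Nat.sum_totient n]
      rw [← Finset.sum_filter]
      apply Finset.sum_congr _ (fun _ _ => rfl)
      ext j
      simp only [Nat.mem_divisors, Finset.mem_filter, Finset.mem_Icc]
      constructor
      · rintro ⟨hd, h0⟩
        have := Nat.le_of_dvd (by omega) hd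
        have := Nat.pos_of_dvd_of_pos hd (by omega)
        exact ⟨by omega, hd⟩
      · rintro ⟨_, hd⟩
        exact ⟨hd, by omega⟩
    rw [Finset.sum_congr rfl hn, Finset.sum_comm]
    apply Finset.sum_congr rfl
    intro j hj
    rw [← Finset.sum_filter, Finset.sum_const, smul_eq_mul, mul_comm]
    congr 1
    have := Nat.Ioc_filter_dvd_card_eq_div J j
    rw [← this]
    rfl
  have h2 : ∑ n ∈ Finset.Icc 1 J, n * 2 = J * (J + 1) := by
    clear h1
    induction J with
    | zero => simp
    | succ J ih => rw [Finset.sum_Icc_succ_top (by omega), ih]; ring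
  have h3 : ∑ j ∈ Finset.Icc 1 J, Nat.totient j * (J / j) ≤
      ∑ j ∈ Finset.Icc 1 J, ((if j ≤ J / 4 then J else 0) + 3 * Nat.totient j) := by
    refine Finset.sum_le_sum fun j hj => ?_
    rw [Finset.mem_Icc] at hj
    split_ifs with h
    · have a : Nat.totient j * (J / j) ≤ j * (J / j) := Nat.mul_le_mul_right _ (Nat.totient_le j)
      have b := Nat.mul_div_le J j
      omega
    · have : J / j ≤ 3 := by
        have : J / j < 4 := by
          rw [Nat.div_lt_iff_lt_mul (by omega)]; omega
        omega
      rw [zero_add, mul_comm]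
      exact Nat.mul_le_mul_right _ this
  have h4 : ∑ j ∈ Finset.Icc 1 J, (if j ≤ J / 4 then J else 0) ≤ (J / 4) * J := by
    rw [← Finset.sum_filter, Finset.sum_const, smul_eq_mul]
    apply Nat.mul_le_mul_right
    calc _ ≤ (Finset.Icc 1 (J / 4)).card := by
          apply Finset.card_le_card
          intro x; simp only [Finset.mem_filter, Finset.mem_Icc]; omega
      _ = _ := by simp
  rw [Finset.sum_add_distrib, ← Finset.mul_sum] at h3
  rw [← Finset.sum_mul] at h2
  have h5 : 4 * ((J / 4) * J) ≤ J * J := by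
    rw [← mul_assoc]; exact Nat.mul_le_mul_right _ (Nat.mul_div_le J 4)
  nlinarith

/-- Level-`L` cells which contain a reduced fraction with denominator at most `J`. -/
def cells (J L : ℕ) : Finset ℕ :=
  ((Finset.Icc 1 J).sigma (fun j => (Finset.range j).filter (fun a => Nat.Coprime j a))).image
    (fun p : (_ : ℕ) × ℕ => L * p.2 / p.1)

theorem cells_inj {J L j a j' a' : ℕ} (hL : J ^ 2 ≤ L) (hj : 1 ≤ j) (hj' : 1 ≤ j')
    (hjJ : j ≤ J) (hjJ' : j' ≤ J) (h : L * a / j = L * a' / j') : a' * j ≤ a * j' := by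
  by_contra hlt
  push Not at hlt
  have h1 : L * a / j * j ≤ L * a := Nat.div_mul_le_self _ _
  have h2 : L * a' < (L * a' / j' + 1) * j' := (Nat.lt_mul_div_succ _ hj').trans_eq (mul_comm _ _)
  rw [← h] at h2
  set q := L * a / j
  have h3 : q * j * j' ≤ L * a * j' := Nat.mul_le_mul_right _ h1
  have h4 : L * a' * j < (q + 1) * j' * j := Nat.mul_lt_mul_of_pos_right h2 hj
  have h5 : L * (a * j' + 1) ≤ L * (a' * j) := Nat.mul_le_mul_left _ hlt
  have h6 : j * j' ≤ J * J := Nat.mul_le_mul hjJ hjJ'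
  nlinarith

theorem cells_card (J L : ℕ) (hL : J ^ 2 ≤ L) : J ^ 2 ≤ 16 * (cells J L).card := by
  unfold cells
  rw [Finset.card_image_of_injOn]
  · rw [Finset.card_sigma]
    refine (totient_sum J).trans (le_of_eq ?_)
    rfl
  · rintro ⟨j, a⟩ h ⟨j', a'⟩ h' e
    simp only [Finset.coe_sigma, Set.mem_sigma_iff, Finset.mem_coe, Finset.mem_Icc,
      Finset.mem_filter, Finset.mem_range] at h h' e
    obtain ⟨⟨hj, hjJ⟩, ha, hc⟩ := h
    obtain ⟨⟨hj', hjJ'⟩, ha', hc'⟩ := h'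
    have e1 := cells_inj hL hj hj' hjJ hjJ' e
    have e2 := cells_inj hL hj' hj hjJ' hjJ e.symm
    have e3 : a * j' = a' * j := le_antisymm e2 e1
    have d1 : j ∣ j' := hc.dvd_of_dvd_mul_left (e3 ▸ Dvd.intro_left _ rfl)
    have d2 : j' ∣ j := hc'.dvd_of_dvd_mul_left (e3 ▸ Dvd.intro_left _ rfl)
    have d3 := Nat.dvd_antisymm d1 d2
    subst d3
    have := Nat.eq_of_mul_eq_mul_right hj e3
    subst this
    rfl

theorem cells_lt (J L x : ℕ) (hL : 0 < L) (hx : x ∈ cells J L) : x < L := by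
  unfold cells at hx
  rw [Finset.mem_image] at hx
  obtain ⟨⟨j, a⟩, h, rfl⟩ := hx
  simp only [Finset.mem_sigma, Finset.mem_Icc, Finset.mem_filter, Finset.mem_range] at h
  rw [Nat.div_lt_iff_lt_mul h.1.1]
  exact Nat.mul_lt_mul_of_pos_left h.2.1 hL

/-- Level exponent at scale `k`. -/
def lv (k : ℕ) : ℕ := 2 * k + 3 - tau k

/-- Denominator bound at scale `k`. -/
def den (k : ℕ) : ℕ := 2 ^ (k - 2 * tau k - 2)

/-- Good cells at scale `k`. -/
def good (k : ℕ) : Finset ℕ := cells (den k) (2 ^ lv k)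

theorem good_card (k : ℕ) (hk : 2 ≤ k) : 2 ^ lv k ≤ 2048 * k * (good k).card := by
  have h1 := tau_le' k hk
  have h2 : den k ^ 2 * (2 ^ 7 * 8 ^ tau k) = 2 ^ lv k := by
    unfold den lv
    rw [← pow_mul, show (8:ℕ) = 2 ^ 3 by norm_num, ← pow_mul, ← pow_add, ← pow_add]
    congr 1
    omega
  have h3 : den k ^ 2 ≤ 2 ^ lv k := by
    rw [← h2]; exact Nat.le_mul_of_pos_right _ (by positivity)
  have h4 := cells_card _ _ h3
  have h5 : 8 ^ tau k ≤ k := Nat.pow_log_le_self 8 (by omega)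
  calc 2 ^ lv k = den k ^ 2 * (2 ^ 7 * 8 ^ tau k) := h2.symm
    _ ≤ (16 * (good k).card) * (2 ^ 7 * k) := Nat.mul_le_mul h4 (Nat.mul_le_mul_left _ h5)
    _ = _ := by ring

theorem good_lt (k x : ℕ) (hx : x ∈ good k) : x < 2 ^ lv k :=
  cells_lt _ _ _ (by positivity) hx

theorem event_approx (k : ℕ) (α : ℝ) (hα : 0 ≤ α)
    (h : ⌊2 ^ (ex (2 ^ k) + lv k) * α⌋₊ % 2 ^ lv k ∈ good k) :
    ∃ j : ℕ, 1 ≤ j ∧ j ≤ den k ∧ ∃ c : ℤ,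
      |α * 2 ^ ex (2 ^ k) * j - c| ≤ j / 2 ^ lv k := by
  unfold good cells at h
  rw [Finset.mem_image] at h
  obtain ⟨⟨j, a⟩, h, he⟩ := h
  simp only [Finset.mem_sigma, Finset.mem_Icc, Finset.mem_filter, Finset.mem_range] at h he
  refine ⟨j, h.1.1, h.1.2, ?_⟩
  set x : ℝ := 2 ^ (ex (2 ^ k) + lv k) * α with hx
  have hx0 : 0 ≤ x := by positivity
  set L : ℕ := 2 ^ lv k with hL
  have hLp : 0 < L := by positivity
  set m := ⌊x⌋₊ / L with hm
  have h1 : L * m + L * a / j = ⌊x⌋₊ := by rw [he]; exact Nat.div_add_mod _ _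
  have h2 : (⌊x⌋₊ : ℝ) ≤ x := Nat.floor_le hx0
  have h3 : x < ⌊x⌋₊ + 1 := Nat.lt_floor_add_one x
  have h4 : L * a / j * j ≤ L * a := Nat.div_mul_le_self _ _
  have h5 : L * a < (L * a / j + 1) * j := (Nat.lt_mul_div_succ _ h.1.1).trans_eq (mul_comm _ _)
  have h6 : (L:ℝ) * m + (L * a / j : ℕ) = ⌊x⌋₊ := by exact_mod_cast h1
  set q := L * a / j
  have h4' : (q:ℝ) * j ≤ L * a := by exact_mod_cast h4
  have h5' : (L:ℝ) * a < (q + 1) * j := by exact_mod_cast h5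
  have hj : (1:ℝ) ≤ j := by exact_mod_cast h.1.1
  refine ⟨m * j + a, ?_⟩
  have hLR : ((2:ℝ) ^ lv k) = L := by rw [hL]; push_cast; rfl
  have hxL : α * 2 ^ ex (2 ^ k) * L = x := by rw [hx, pow_add, hLR]; ring
  have hLpos : (0:ℝ) < L := by exact_mod_cast hLp
  rw [hLR, le_div_iff₀ hLpos]
  rw [show ∀ y : ℝ, |y| * L = |y * L| from fun y => by rw [abs_mul, abs_of_pos hLpos]]
  have e : (α * 2 ^ ex (2 ^ k) * j - ((m * j + a : ℤ) : ℝ)) * L = x * j - L * m * j - L * a := by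
    rw [← hxL]; push_cast; ring
  push_cast at e ⊢
  rw [e, abs_le]
  constructor <;> nlinarith

theorem event_corr (k : ℕ) (hk : 2 ≤ k) (α : ℝ) (hα : 0 ≤ α)
    (h : ⌊2 ^ (ex (2 ^ k) + lv k) * α⌋₊ % 2 ^ lv k ∈ good k) :
    1 / 2 ≤ pairCorr sqn α (1 / 8) (2 ^ (k + 1)) := by
  obtain ⟨j, hj1, hjJ, c, hc⟩ := event_approx k α hα h
  have ht := tau_le' k hk
  have hblk : den k * 2 ^ (tau k + 1) * 2 = blk k := by
    unfold den blk
    rw [← pow_add, ← pow_succ]; congr 1; omega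
  have hblk2 : 2 ^ (tau k + 1) * 2 ^ (k - tau k - 1) = 2 ^ k := by
    rw [← pow_add]; congr 1; omega
  have hblk3 : 2 ^ (k - tau k - 1) * 2 = blk k := by
    unfold blk
    rw [← pow_succ]; congr 1; omega
  have hlv : den k * 2 ^ (tau k + 1) * (8 * 2 ^ (k + 1)) = 2 ^ lv k := by
    unfold den lv
    rw [show (8:ℕ) = 2 ^ 3 by norm_num, ← pow_add, ← pow_add, ← pow_add]; congr 1; omega
  have hble := blk_le k
  unfold pairCorr
  rw [le_div_iff₀ (by positivity)]
  have hcard : 2 ^ k ≤ ((Finset.Icc 1 (2 ^ (k + 1)) ×ˢ Finset.Icc 1 (2 ^ (k + 1))).filter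
    (fun p => p.1 ≠ p.2 ∧ intDist (α * ((sqn p.1 : ℝ) - (sqn p.2 : ℝ))) ≤
      (1 / 8) / ((2 ^ (k + 1) : ℕ) : ℝ))).card := by
    have hc0 : (Finset.Icc 1 (2 ^ (tau k + 1)) ×ˢ Finset.range (2 ^ (k - tau k - 1))).card
        = 2 ^ k := by
      rw [Finset.card_product]; simp [hblk2]
    rw [← hc0]
    apply Finset.card_le_card_of_injOn (fun p => (2 ^ k + p.2 + j * p.1, 2 ^ k + p.2))
    · rintro ⟨i, u⟩ hp
      simp only [Finset.coe_product, Set.mem_prod, Finset.mem_coe, Finset.mem_Icc,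
        Finset.mem_range] at hp
      obtain ⟨⟨hi1, hi2⟩, hu⟩ := hp
      have hji : j * i ≤ den k * 2 ^ (tau k + 1) := Nat.mul_le_mul hjJ hi2
      have hji1 : 0 < j * i := by positivity
      have hpos : 0 < 2 ^ k := by positivity
      have e1 : hd (2 ^ k + u + j * i) = 2 ^ k := hd_block _ _ (by omega) (by omega)
      have e2 : hd (2 ^ k + u) = 2 ^ k := hd_block _ _ (by omega) (by omega)
      have e3 : sqn (2 ^ k + u + j * i) = sqn (2 ^ k + u) + 2 ^ ex (2 ^ k) * (j * i) := by
        unfold sqn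
        rw [e1, e2, ← mul_add]; congr 1; omega
      rw [Finset.mem_coe, Finset.mem_filter, Finset.mem_product, Finset.mem_Icc, Finset.mem_Icc]
      have hp2 : 2 ^ (k + 1) = 2 * 2 ^ k := by rw [pow_succ]; ring
      refine ⟨⟨⟨by simp only; omega, by simp only; omega⟩,
        ⟨by simp only; omega, by simp only; omega⟩⟩, by simp only; omega, ?_⟩
      simp only
      rw [e3]
      unfold intDist
      refine (round_le _ (c * i)).trans ?_
      have e4 : α * (((sqn (2 ^ k + u) + 2 ^ ex (2 ^ k) * (j * i) : ℕ) : ℝ) - (sqn (2 ^ k + u) : ℝ))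
          - ((c * i : ℤ) : ℝ) = (α * 2 ^ ex (2 ^ k) * j - c) * i := by
        push_cast; ring
      rw [e4, abs_mul, Nat.abs_cast]
      calc |α * 2 ^ ex (2 ^ k) * j - c| * (i:ℝ) ≤ j / 2 ^ lv k * i := by gcongr
        _ = ((j * i : ℕ) : ℝ) / 2 ^ lv k := by push_cast; ring
        _ ≤ ((den k * 2 ^ (tau k + 1) : ℕ) : ℝ) / 2 ^ lv k := by gcongr
        _ = _ := by
          have hlv' : ((den k * 2 ^ (tau k + 1) : ℕ) : ℝ) * (8 * ((2 ^ (k + 1) : ℕ) : ℝ))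
            = 2 ^ lv k := by exact_mod_cast hlv
          rw [← hlv']
          have : (0:ℝ) < ((den k * 2 ^ (tau k + 1) : ℕ) : ℝ) := by
            have : 0 < den k := by unfold den; positivity
            positivity
          field_simp
    · rintro ⟨i, u⟩ hp ⟨i', u'⟩ hp' e
      simp only [Prod.mk.injEq] at e
      have hu : u = u' := by omega
      subst hu
      have : j * i = j * i' := by omega
      rw [Nat.eq_of_mul_eq_mul_left hj1 this]
  have hcard' := (Nat.cast_le (α := ℝ)).2 hcard
  refine le_trans (le_of_eq ?_) hcard'
  push_cast
  rw [pow_succ]; ring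

theorem level_step (k : ℕ) : ex (2 ^ k) + lv k ≤ ex (2 ^ (k + 1)) := by
  unfold ex lv
  have h : k < 2 ^ k := Nat.lt_two_pow_self
  rw [pow_succ 2 k]
  generalize 2 ^ k = y at h
  have : 2 * k + 3 - tau k ≤ 2 * y + 3 := by omega
  nlinarith

theorem avoid_cover (K₀ : ℕ) (hK : 2 ≤ K₀) (G : Set ℝ)
    (hG : ∀ α ∈ G, 0 ≤ α ∧ α < 1 ∧ ∀ k, K₀ ≤ k →
      ⌊2 ^ (ex (2 ^ k) + lv k) * α⌋₊ % 2 ^ lv k ∉ good k) (n : ℕ) :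
    ∃ Z : Finset ℕ, (∀ α ∈ G, ⌊2 ^ ex (2 ^ (K₀ + n)) * α⌋₊ ∈ Z) ∧
      (Z.card : ℝ) ≤ 2 ^ ex (2 ^ (K₀ + n)) *
        ∏ i ∈ Finset.range n, (1 - 1 / (2048 * ((K₀ + i : ℕ) : ℝ))) := by
  induction n with
  | zero =>
    refine ⟨Finset.range (2 ^ ex (2 ^ K₀)), ?_, by simp⟩
    intro α hα
    obtain ⟨h0, h1, -⟩ := hG α hα
    rw [Finset.mem_range, Nat.floor_lt (by positivity)]
    push_cast
    have : (0:ℝ) < 2 ^ ex (2 ^ K₀) := by positivity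
    simp only [add_zero]
    nlinarith
  | succ n ih =>
    obtain ⟨Z, hZ, hc⟩ := ih
    set k := K₀ + n with hk
    obtain ⟨g, hg⟩ := Nat.exists_eq_add_of_le (level_step k)
    refine ⟨((Z ×ˢ (Finset.range (2 ^ lv k) \ good k)) ×ˢ Finset.range (2 ^ g)).image
      (fun p => (p.1.1 * 2 ^ lv k + p.1.2) * 2 ^ g + p.2), ?_, ?_⟩
    · intro α hα
      obtain ⟨h0, h1, h2⟩ := hG α hα
      have hav := h2 k (by omega)
      have hz := hZ α hα
      have e1 : ⌊2 ^ ex (2 ^ (k + 1)) * α⌋₊ / 2 ^ g = ⌊2 ^ (ex (2 ^ k) + lv k) * α⌋₊ := by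
        rw [← Nat.floor_div_natCast, hg, pow_add _ _ g]
        congr 1
        push_cast
        field_simp
      have e2 : ⌊2 ^ (ex (2 ^ k) + lv k) * α⌋₊ / 2 ^ lv k = ⌊2 ^ ex (2 ^ k) * α⌋₊ := by
        rw [← Nat.floor_div_natCast, pow_add]
        congr 1
        push_cast
        field_simp
      rw [Finset.mem_image]
      refine ⟨((⌊2 ^ ex (2 ^ k) * α⌋₊, ⌊2 ^ (ex (2 ^ k) + lv k) * α⌋₊ % 2 ^ lv k),
        ⌊2 ^ ex (2 ^ (k + 1)) * α⌋₊ % 2 ^ g), ?_, ?_⟩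
      · simp only [Finset.mem_product, Finset.mem_sdiff, Finset.mem_range]
        exact ⟨⟨hz, Nat.mod_lt _ (by positivity), hav⟩, Nat.mod_lt _ (by positivity)⟩
      · simp only
        rw [← e2, Nat.div_add_mod', ← e1, Nat.div_add_mod']
        rfl
    · have hcard : (Finset.range (2 ^ lv k) \ good k).card + (good k).card = 2 ^ lv k := by
        rw [Finset.card_sdiff_add_card_eq_card, Finset.card_range]
        intro x hx
        exact Finset.mem_range.2 (good_lt k x hx)
      have hgc := good_card k (by omega)
      have hkpos : (0:ℝ) < k := by
        have : 0 < k := by omega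
        exact_mod_cast this
      have hbad : ((Finset.range (2 ^ lv k) \ good k).card : ℝ) ≤
          2 ^ lv k * (1 - 1 / (2048 * (k : ℝ))) := by
        have a : ((Finset.range (2 ^ lv k) \ good k).card : ℝ) + (good k).card = 2 ^ lv k := by
          exact_mod_cast hcard
        have b : (2 : ℝ) ^ lv k ≤ 2048 * k * (good k).card := by exact_mod_cast hgc
        have c : (2 : ℝ) ^ lv k * (1 / (2048 * (k : ℝ))) ≤ (good k).card := by
          rw [mul_one_div, div_le_iff₀ (by positivity)]
          linarith
        linarith
      have h1 := Finset.card_image_le (s := (Z ×ˢ (Finset.range (2 ^ lv k) \ good k)) ×ˢ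
        Finset.range (2 ^ g)) (f := fun p => (p.1.1 * 2 ^ lv k + p.1.2) * 2 ^ g + p.2)
      rw [Finset.card_product, Finset.card_product, Finset.card_range] at h1
      have h1' := (Nat.cast_le (α := ℝ)).2 h1
      push_cast at h1'
      refine h1'.trans ?_
      have e : (2:ℝ) ^ ex (2 ^ (K₀ + (n + 1))) = 2 ^ ex (2 ^ k) * 2 ^ lv k * 2 ^ g := by
        rw [← pow_add, ← pow_add, ← hg, hk]; rfl
      rw [e, Finset.prod_range_succ]
      calc (Z.card : ℝ) * ((Finset.range (2 ^ lv k) \ good k).card : ℝ) * 2 ^ g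
          ≤ (2 ^ ex (2 ^ k) *
            ∏ i ∈ Finset.range n, (1 - 1 / (2048 * ((K₀ + i : ℕ) : ℝ)))) *
            (2 ^ lv k * (1 - 1 / (2048 * (k : ℝ)))) * 2 ^ g := by
            gcongr
            exact le_trans (Nat.cast_nonneg _) hc
        _ = _ := by ring

theorem prod_tendsto (K₀ : ℕ) (hK : 2 ≤ K₀) :
    Tendsto (fun n => ∏ i ∈ Finset.range n, (1 - 1 / (2048 * ((K₀ + i : ℕ) : ℝ))))
      atTop (nhds 0) := by
  have hsum : Tendsto (fun n => ∑ i ∈ Finset.range n, 1 / (2048 * ((K₀ + i : ℕ) : ℝ)))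
      atTop atTop := by
    have h := (Real.tendsto_sum_range_one_div_nat_succ_atTop).const_mul_atTop
      (show (0:ℝ) < 1 / (2048 * K₀) by positivity)
    refine tendsto_atTop_mono (fun n => ?_) h
    rw [Finset.mul_sum]
    refine Finset.sum_le_sum fun i _ => ?_
    rw [one_div_mul_one_div]
    have hK' : (2:ℝ) ≤ K₀ := by exact_mod_cast hK
    have hi : (0:ℝ) ≤ i := by positivity
    apply one_div_le_one_div_of_le
    · positivity
    · push_cast
      nlinarith
  have hexp : Tendsto (fun n => Real.exp (-∑ i ∈ Finset.range n,
      1 / (2048 * ((K₀ + i : ℕ) : ℝ)))) atTop (nhds 0) :=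
    Real.tendsto_exp_neg_atTop_nhds_zero.comp hsum
  have hterm : ∀ i : ℕ, (0:ℝ) ≤ 1 - 1 / (2048 * ((K₀ + i : ℕ) : ℝ)) := by
    intro i
    have : (1:ℝ) ≤ 2048 * ((K₀ + i : ℕ) : ℝ) := by
      have : 1 ≤ 2048 * (K₀ + i) := by omega
      exact_mod_cast this
    rw [sub_nonneg]
    exact (div_le_one (by linarith)).2 this
  refine squeeze_zero (fun n => Finset.prod_nonneg fun i _ => hterm i) (fun n => ?_) hexp
  rw [← Finset.sum_neg_distrib, Real.exp_sum]
  refine Finset.prod_le_prod (fun i _ => hterm i) fun i _ => ?_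
  exact Real.one_sub_le_exp_neg _

theorem cover_volume (Q : ℕ) (hQ : 0 < Q) (G : Set ℝ) (Z : Finset ℕ)
    (h0 : ∀ α ∈ G, 0 ≤ α) (hG : ∀ α ∈ G, ⌊(Q : ℝ) * α⌋₊ ∈ Z) :
    volume G ≤ ENNReal.ofReal (Z.card / Q) := by
  have hQ' : (0:ℝ) < Q := by exact_mod_cast hQ
  have hsub : G ⊆ ⋃ m ∈ Z, Set.Ico ((m:ℝ) / Q) ((m + 1) / Q) := by
    intro α hα
    simp only [Set.mem_iUnion]
    refine ⟨_, hG α hα, ?_, ?_⟩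
    · rw [div_le_iff₀ hQ', mul_comm α]
      exact Nat.floor_le (mul_nonneg hQ'.le (h0 α hα))
    · rw [lt_div_iff₀ hQ', mul_comm α]
      exact Nat.lt_floor_add_one _
  refine (measure_mono hsub).trans ((measure_biUnion_finset_le _ _).trans ?_)
  have : ∀ m ∈ Z, volume (Set.Ico ((m:ℝ) / Q) ((m + 1) / Q)) = ENNReal.ofReal (1 / Q) := by
    intro m _
    rw [Real.volume_Ico]
    congr 1
    ring
  rw [Finset.sum_congr rfl this, Finset.sum_const, nsmul_eq_mul, ← ENNReal.ofReal_natCast,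
    ← ENNReal.ofReal_mul (by positivity), mul_one_div]

theorem avoid_null (K₀ : ℕ) (hK : 2 ≤ K₀) (G : Set ℝ)
    (hG : ∀ α ∈ G, 0 ≤ α ∧ α < 1 ∧ ∀ k, K₀ ≤ k →
      ⌊2 ^ (ex (2 ^ k) + lv k) * α⌋₊ % 2 ^ lv k ∉ good k) : volume G = 0 := by
  have hb : ∀ n, volume G ≤ ENNReal.ofReal
      (∏ i ∈ Finset.range n, (1 - 1 / (2048 * ((K₀ + i : ℕ) : ℝ)))) := by
    intro n
    obtain ⟨Z, hZ, hc⟩ := avoid_cover K₀ hK G hG n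
    refine (cover_volume (2 ^ ex (2 ^ (K₀ + n))) (by positivity) G Z
      (fun α hα => (hG α hα).1) ?_).trans ?_
    · intro α hα
      push_cast
      exact hZ α hα
    · apply ENNReal.ofReal_le_ofReal
      rw [div_le_iff₀ (by positivity)]
      rw [mul_comm]
      push_cast at hc ⊢
      exact hc
  have ht := ENNReal.tendsto_ofReal (prod_tendsto K₀ hK)
  rw [ENNReal.ofReal_zero] at ht
  exact le_antisymm (ge_of_tendsto' ht hb) bot_le

theorem sqn_not_poissonian : ¬ MetricPoissonian sqn := by
  intro hP
  unfold MetricPoissonian at hP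
  rw [ae_restrict_iff' measurableSet_Icc] at hP
  have hev : ∀ K₀ : ℕ, ∀ᵐ α : ℝ, 0 ≤ α → α < 1 → ∃ k, K₀ + 2 ≤ k ∧
      ⌊2 ^ (ex (2 ^ k) + lv k) * α⌋₊ % 2 ^ lv k ∈ good k := by
    intro K₀
    rw [ae_iff]
    apply avoid_null (K₀ + 2) (by omega)
    intro α hα
    simp only [Set.mem_ofPred_eq] at hα
    push Not at hα
    exact ⟨hα.1, hα.2.1, hα.2.2⟩
  rw [← ae_all_iff] at hev
  have hall := hP.and hev
  have hex : ∃ α : ℝ, α ∈ Set.Ioo (0:ℝ) 1 ∧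
      ((α ∈ Set.Icc (0:ℝ) 1 → ∀ s : ℝ, 0 < s →
        Tendsto (fun N => pairCorr sqn α s N) atTop (nhds (2 * s))) ∧
      ∀ K₀ : ℕ, 0 ≤ α → α < 1 → ∃ k, K₀ + 2 ≤ k ∧
        ⌊2 ^ (ex (2 ^ k) + lv k) * α⌋₊ % 2 ^ lv k ∈ good k) := by
    by_contra hno
    push Not at hno
    have hnull : volume (Set.Ioo (0:ℝ) 1) = 0 := by
      refine measure_mono_null ?_ (ae_iff.1 hall)
      intro α hα hc
      obtain ⟨K₀, h0, h1, hk⟩ := hno α hα hc.1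
      obtain ⟨k, hk1, hk2⟩ := hc.2 K₀ h0 h1
      exact hk k hk1 hk2
    simp at hnull
  obtain ⟨α, hα, hT, hE⟩ := hex
  have hlim := hT ⟨hα.1.le, hα.2.le⟩ (1 / 8) (by norm_num)
  have hlt : ∀ᶠ N in atTop, pairCorr sqn α (1 / 8) N < 1 / 2 :=
    hlim.eventually_lt_const (by norm_num)
  obtain ⟨N₀, hN₀⟩ := eventually_atTop.1 hlt
  obtain ⟨k, hk, hg⟩ := hE N₀ hα.1.le hα.2
  have h1 := event_corr k (by omega) α hα.1.le hg
  have h2 : N₀ ≤ 2 ^ (k + 1) := by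
    have : k + 1 < 2 ^ (k + 1) := Nat.lt_two_pow_self
    omega
  exact absurd (hN₀ _ h2) (not_lt.2 h1)

/-- There is an infinite set `𝒜` with `E(A_N) ≤ C·N³/log N` for all `N ≥ 2` which is
nevertheless not metric Poissonian. -/
theorem exists_small_energy_not_metricPoissonian :
    ∃ a : ℕ → ℕ, StrictMono a ∧
      (∃ C : ℝ, 0 < C ∧ ∀ N : ℕ, 2 ≤ N →
        (addEnergy (firstN a N) : ℝ) ≤ C * (N : ℝ) ^ 3 / Real.log N) ∧
      ¬ MetricPoissonian a := by
  exact ⟨sqn, sqn_strictMono, ⟨19, by norm_num, energy_bound⟩, sqn_not_poissonian⟩
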